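/- If an (n−1)-CNF F in n variables has a resolution refutation of height h and length s, then F has a resolution refutation of h levels of 3s clauses. -/

import Mathlib

open Classical Finset

structure Lit (V : Type) where
  var : V
  pos : Bool
deriving DecidableEq

abbrev Clause (V : Type) := Finset (Lit V)
abbrev PTerm (V : Type) := Finset (Lit V)
abbrev Cnf (V : Type) := Finset (Clause V)
abbrev Dnf (V : Type) := Finset (PTerm V)

variable {V : Type} [DecidableEq V]

def Lit.neg (l : Lit V) : Lit V := ⟨l.var, !l.pos⟩

/-- A clause viewed as a 1-DNF. -/
def clauseToDnf (C : Clause V) : Dnf V := C.image (fun l => {l})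

/-- A `k`-DNF: every term has at most `k` literals. -/
def IsKDnf (k : ℕ) (G : Dnf V) : Prop := ∀ q ∈ G, q.card ≤ k

/-- The inference rules of Res(k): axiom, weakening, ∧-introduction and cut. -/
inductive ResKInf (k : ℕ) : List (Dnf V) → Dnf V → Prop
  | ax (x : V) :
      ResKInf k [] {{(⟨x, true⟩ : Lit V)}, {(⟨x, false⟩ : Lit V)}}
  | weaken (A B : Dnf V) : ResKInf k [A] (A ∪ B)
  | andIntro (A B : Dnf V) (l : Lit V) (q : PTerm V) (hq : q.card + 1 ≤ k) :
      ResKInf k [A ∪ {({l} : PTerm V)}, B ∪ {q}] (A ∪ B ∪ {insert l q})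
  | cut (A B : Dnf V) (q : PTerm V) :
      ResKInf k [A ∪ {q}, B ∪ q.image (fun l => ({l.neg} : PTerm V))] (A ∪ B)

/-- A Res(k) refutation of the CNF `F`: a sequence of k-DNFs, each a clause of `F`
or inferred from earlier lines, ending with the empty clause. -/
def IsResKRefutation (k : ℕ) (F : Set (Clause V)) (P : List (Dnf V)) : Prop :=
  P ≠ [] ∧ P.getLast? = some (∅ : Dnf V) ∧ (∀ G ∈ P, IsKDnf k G) ∧
  ∀ i : Fin P.length,
    (∃ C ∈ F, P.get i = clauseToDnf C) ∨
    ∃ prems : List (Dnf V), ResKInf k prems (P.get i) ∧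
      ∀ Q ∈ prems, ∃ j : Fin P.length, (j : ℕ) < (i : ℕ) ∧ P.get j = Q

/-- The number of symbols in a DNF. -/
def dnfSize (G : Dnf V) : ℕ := ∑ q ∈ G, (q.card + 1)

/-- The size (number of symbols) of a Res(k) refutation. -/
def proofSize (P : List (Dnf V)) : ℕ := (P.map dnfSize).sum

/-- The size (number of symbols) of a CNF. -/
def cnfSize (F : Cnf V) : ℕ := ∑ C ∈ F, (C.card + 1)

/-- The set of propositional variables occurring in a CNF. -/
def cnfVars (F : Cnf V) : Finset V := F.sup (fun C => C.image Lit.var)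

def SatClauseA (a : V → Bool) (C : Clause V) : Prop := ∃ l ∈ C, a l.var = l.pos

/-- Unsatisfiability of a CNF. -/
def Unsat (F : Set (Clause V)) : Prop := ¬ ∃ a : V → Bool, ∀ C ∈ F, SatClauseA a C

def litSatP (π : V → Option Bool) (l : Lit V) : Prop := π l.var = some l.pos
def litFalsP (π : V → Option Bool) (l : Lit V) : Prop := π l.var = some (!l.pos)

/-- A partial assignment satisfies a term if it satisfies all its literals. -/
def satPTerm (π : V → Option Bool) (q : PTerm V) : Prop := ∀ l ∈ q, litSatP π l
/-- A partial assignment falsifies a term if it falsifies some literal of it. -/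
def falsPTerm (π : V → Option Bool) (q : PTerm V) : Prop := ∃ l ∈ q, litFalsP π l

/-- The restriction of a DNF by a partial assignment: falsified terms are removed,
and satisfied literals are removed from the remaining terms. -/
noncomputable def restrictDnf (G : Dnf V) (π : V → Option Bool) : Dnf V :=
  (G.filter (fun q => ¬ falsPTerm π q)).image (fun q => q.filter (fun l => ¬ litSatP π l))

def clauseSatP (π : V → Option Bool) (C : Clause V) : Prop := ∃ l ∈ C, litSatP π l

/-- The restriction of a clause: falsified literals are removed. -/
noncomputable def restrictClause (C : Clause V) (π : V → Option Bool) : Clause V :=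
  C.filter (fun l => ¬ litFalsP π l)

/-- The restriction of a CNF by a partial assignment: satisfied clauses are removed,
falsified literals are removed from the remaining clauses. -/
def restrictCnfSet (F : Set (Clause V)) (π : V → Option Bool) : Set (Clause V) :=
  {E | ∃ C ∈ F, ¬ clauseSatP π C ∧ E = restrictClause C π}

/-- A resolution refutation of the CNF `F` (weakening is built into the rules). -/
def IsResRefutation (F : Set (Clause V)) (P : List (Clause V)) : Prop :=
  P ≠ [] ∧ P.getLast? = some (∅ : Clause V) ∧
  ∀ i : Fin P.length,
    (∃ C ∈ F, C ⊆ P.get i) ∨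
    ∃ jv jw : Fin P.length, (jv : ℕ) < (i : ℕ) ∧ (jw : ℕ) < (i : ℕ) ∧ ∃ x : V,
      (⟨x, true⟩ : Lit V) ∈ P.get jv ∧ (⟨x, false⟩ : Lit V) ∈ P.get jw ∧
      ((P.get jv).erase ⟨x, true⟩ ∪ (P.get jw).erase ⟨x, false⟩) ⊆ P.get i

/-- A step of a resolution derivation, recording how its clause is obtained:
`ax C` is a weakening of a clause of the initial CNF, `res C v w x` is a weakening of
the resolvent of the clauses at the (earlier) positions `v` and `w` on the variable `x`. -/
inductive RStep (V : Type) : Type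
  | ax (C : Clause V)
  | res (C : Clause V) (v w : ℕ) (x : V)

/-- The clause of a step. -/
def RStep.clause {V : Type} : RStep V → Clause V
  | .ax C => C
  | .res C _ _ _ => C

/-- A resolution derivation from the CNF `F`, with recorded inference structure. -/
def IsResDeriv {V : Type} [DecidableEq V] (F : Set (Clause V)) (P : List (RStep V)) : Prop :=
  ∀ i : Fin P.length,
    match P.get i with
    | .ax C => ∃ C₀ ∈ F, C₀ ⊆ C
    | .res C v w x =>
        ∃ hv : v < P.length, ∃ hw : w < P.length, v < (i : ℕ) ∧ w < (i : ℕ) ∧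
          (⟨x, true⟩ : Lit V) ∈ (P.get ⟨v, hv⟩).clause ∧
          (⟨x, false⟩ : Lit V) ∈ (P.get ⟨w, hw⟩).clause ∧
          (((P.get ⟨v, hv⟩).clause.erase ⟨x, true⟩) ∪
            ((P.get ⟨w, hw⟩).clause.erase ⟨x, false⟩)) ⊆ C

/-- The clause at position `u` is a premise of the resolution rule by which the clause at
position `u'` is obtained. -/
def IsPremise {V : Type} (P : List (RStep V)) (u u' : ℕ) : Prop :=
  ∃ h : u' < P.length,
    match P.get ⟨u', h⟩ with
    | .ax _ => False
    | .res _ v w _ => u = v ∨ u = w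

/-- A height-witnessing chain in the derivation: a subsequence of positions in which each
clause is a premise of the rule by which the next one is obtained. -/
def IsHChain {V : Type} (P : List (RStep V)) (us : List ℕ) : Prop :=
  us ≠ [] ∧ (∀ u ∈ us, u < P.length) ∧
  us.Chain' (fun a b => a < b ∧ IsPremise P a b)

/-- The height of a resolution derivation: the maximum length of a chain. -/
noncomputable def derivHeight {V : Type} (P : List (RStep V)) : ℕ :=
  sSup {h : ℕ | ∃ us : List ℕ, IsHChain P us ∧ us.length = h}

/-- `F` has a resolution refutation of `s` levels of `t` clauses. -/
def HasLevelRefutation {V : Type} [DecidableEq V] (F : Set (Clause V)) (s t : ℕ) : Prop :=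
  ∃ Cl : ℕ → ℕ → Clause V,
    (∀ j ∈ Finset.Icc 1 t, ∃ C₀ ∈ F, C₀ ⊆ Cl 1 j) ∧
    (∀ i ∈ Finset.Icc 2 s, ∀ j ∈ Finset.Icc 1 t,
      ∃ j₁ ∈ Finset.Icc 1 t, ∃ j₂ ∈ Finset.Icc 1 t, ∃ x : V,
        (⟨x, true⟩ : Lit V) ∈ Cl (i-1) j₁ ∧ (⟨x, false⟩ : Lit V) ∈ Cl (i-1) j₂ ∧
        (((Cl (i-1) j₁).erase ⟨x, true⟩) ∪ ((Cl (i-1) j₂).erase ⟨x, false⟩)) ⊆ Cl i j) ∧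
    Cl s t = ∅

/-- The step at position `u` can be derived within the first `i + 1` levels. -/
def AvailableAt {V : Type} (P : List (RStep V)) : ℕ → ℕ → Prop
  | 0, u => ∃ C, P[u]? = some (.ax C)
  | i + 1, u => AvailableAt P i u ∨
      ∃ C v w x, P[u]? = some (.res C v w x) ∧ AvailableAt P i v ∧ AvailableAt P i w

theorem AvailableAt.mono {V : Type} {P : List (RStep V)} {u i k : ℕ}
    (hu : AvailableAt P i u) (hik : i ≤ k) : AvailableAt P k u := by
  induction hik with
  | refl => exact hu
  | step _ ih => exact Or.inl ih

theorem AvailableAt.lt_length {V : Type} {P : List (RStep V)} {u i : ℕ}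
    (hu : AvailableAt P i u) : u < P.length := by
  induction i with
  | zero =>
    obtain ⟨C, hC⟩ := hu
    exact (List.getElem?_eq_some_iff.1 hC).1
  | succ i ih =>
    rcases hu with hu | ⟨C, v, w, x, hC, -⟩
    · exact ih hu
    · exact (List.getElem?_eq_some_iff.1 hC).1

theorem IsHChain.length_le {V : Type} {P : List (RStep V)} {us : List ℕ}
    (hus : IsHChain P us) : us.length ≤ P.length := by
  have hlt : us.IsChain (· < ·) := hus.2.2.imp fun _ _ h => h.1
  have hnodup : us.Nodup := (List.isChain_iff_pairwise.1 hlt).imp fun h => h.ne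
  rw [← List.toFinset_card_of_nodup hnodup, ← Finset.card_range P.length]
  exact Finset.card_le_card fun u hu => by simpa using hus.2.1 u (by simpa using hu)

theorem IsHChain.length_le_derivHeight {V : Type} {P : List (RStep V)} {us : List ℕ}
    (hus : IsHChain P us) : us.length ≤ derivHeight P :=
  le_csSup ⟨P.length, by rintro _ ⟨vs, hvs, rfl⟩; exact hvs.length_le⟩ ⟨us, hus, rfl⟩

theorem IsHChain.concat {V : Type} {P : List (RStep V)} {us : List ℕ} {v u : ℕ}
    (hus : IsHChain P us) (hv : us.getLast? = some v) (hvu : v < u) (hp : IsPremise P v u) :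
    IsHChain P (us ++ [u]) := by
  refine ⟨by simp, ?_, ?_⟩
  · intro a ha
    rcases List.mem_append.1 ha with ha | ha
    · exact hus.2.1 a ha
    · obtain rfl := List.mem_singleton.1 ha
      exact hp.1
  · refine List.isChain_append.2 ⟨hus.2.2, by simp, ?_⟩
    intro a ha b hb
    simp_all

theorem IsResDeriv.exists_chain_available {V : Type} [DecidableEq V] {F : Set (Clause V)}
    {P : List (RStep V)} (hP : IsResDeriv F P) (u : ℕ) (hu : u < P.length) :
    ∃ k us, IsHChain P us ∧ us.getLast? = some u ∧ us.length = k + 1 ∧ AvailableAt P k u := by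
  induction u using Nat.strong_induction_on with
  | _ u ih =>
    have hstep := hP ⟨u, hu⟩
    cases hPu : P[u] with
    | ax C =>
      exact ⟨0, [u], ⟨by simp, by simpa using hu, List.isChain_singleton _⟩, rfl, rfl, C,
        List.getElem?_eq_some_iff.2 ⟨hu, hPu⟩⟩
    | res C v w x =>
      simp only [List.get_eq_getElem, hPu] at hstep
      obtain ⟨hv, hw, hvu, hwu, -⟩ := hstep
      obtain ⟨k, us, hus, hlast, hlen, hk⟩ := ih v hvu hv
      obtain ⟨m, vs, hvs, hlast', hlen', hm⟩ := ih w hwu hw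
      have hu' : P[u]? = some (.res C v w x) := List.getElem?_eq_some_iff.2 ⟨hu, hPu⟩
      rcases le_total m k with hmk | hkm
      · refine ⟨k + 1, us ++ [u], hus.concat hlast hvu ⟨hu, ?_⟩, by simp, by simp [hlen],
          Or.inr ⟨C, v, w, x, hu', hk, hm.mono hmk⟩⟩
        simp [hPu]
      · refine ⟨m + 1, vs ++ [u], hvs.concat hlast' hwu ⟨hu, ?_⟩, by simp, by simp [hlen'],
          Or.inr ⟨C, v, w, x, hu', hk.mono hkm, hm⟩⟩
        simp [hPu]

theorem IsResDeriv.availableAt_height {V : Type} [DecidableEq V] {F : Set (Clause V)}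
    {P : List (RStep V)} (hP : IsResDeriv F P) {u : ℕ} (hu : u < P.length) :
    AvailableAt P (derivHeight P - 1) u := by
  obtain ⟨k, us, hus, -, hlen, hk⟩ := hP.exists_chain_available u hu
  have := hus.length_le_derivHeight
  exact hk.mono (by omega)

theorem IsResDeriv.availableAt_zero_zero {V : Type} [DecidableEq V] {F : Set (Clause V)}
    {P : List (RStep V)} (hP : IsResDeriv F P) (hne : P ≠ []) : AvailableAt P 0 0 := by
  have h0 : 0 < P.length := List.length_pos_iff.2 hne
  have hstep := hP ⟨0, h0⟩
  cases hP0 : P[0] with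
  | ax C => exact ⟨C, List.getElem?_eq_some_iff.2 ⟨h0, hP0⟩⟩
  | res C v w x =>
    simp only [List.get_eq_getElem, hP0] at hstep
    obtain ⟨-, -, hv, -⟩ := hstep
    exact absurd hv (Nat.not_lt_zero _)

/-- The clause at position `u`, with the junk value `∅` past the end. -/
def clauseAt {V : Type} (P : List (RStep V)) (u : ℕ) : Clause V :=
  (P[u]?.map RStep.clause).getD ∅

theorem IsResDeriv.subset_clauseAt {V : Type} [DecidableEq V] {F : Set (Clause V)}
    {P : List (RStep V)} (hP : IsResDeriv F P) {u : ℕ} {C : Clause V}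
    (hu : P[u]? = some (.ax C)) : ∃ C₀ ∈ F, C₀ ⊆ clauseAt P u := by
  obtain ⟨h, hPu⟩ := List.getElem?_eq_some_iff.1 hu
  have hstep := hP ⟨u, h⟩
  simp only [List.get_eq_getElem, hPu] at hstep
  simpa [clauseAt, hu, RStep.clause] using hstep

theorem IsResDeriv.resolvent_subset_clauseAt {V : Type} [DecidableEq V] {F : Set (Clause V)}
    {P : List (RStep V)} (hP : IsResDeriv F P) {u v w : ℕ} {x : V} {C : Clause V}
    (hu : P[u]? = some (.res C v w x)) :
    (⟨x, true⟩ : Lit V) ∈ clauseAt P v ∧ (⟨x, false⟩ : Lit V) ∈ clauseAt P w ∧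
      (clauseAt P v).erase ⟨x, true⟩ ∪ (clauseAt P w).erase ⟨x, false⟩ ⊆ clauseAt P u := by
  obtain ⟨h, hPu⟩ := List.getElem?_eq_some_iff.1 hu
  have hstep := hP ⟨u, h⟩
  simp only [List.get_eq_getElem, hPu] at hstep
  obtain ⟨hv, hw, -, -, hstep⟩ := hstep
  simpa [clauseAt, hu, hv, hw, RStep.clause] using hstep

/-- The `r`-th padding of a clause: for `r = 0, 1` a literal of `y` is added. -/
def padClause {V : Type} [DecidableEq V] (y : V) (C : Clause V) : ℕ → Clause V
  | 0 => insert ⟨y, true⟩ C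
  | 1 => insert ⟨y, false⟩ C
  | _ => C

theorem subset_padClause {V : Type} [DecidableEq V] (y : V) (C : Clause V) (r : ℕ) :
    C ⊆ padClause y C r := by
  unfold padClause
  split
  · exact Finset.subset_insert _ _
  · exact Finset.subset_insert _ _
  · exact Finset.Subset.refl _

/-- A refutation of length `s` and height `h` yields one of `h` levels of `3 * s` clauses:
each clause is kept from its own level on, by resolving its two paddings by a fixed variable. -/
theorem IsResDeriv.hasLevelRefutation {V : Type} [DecidableEq V] [Nonempty V]
    {F : Set (Clause V)} {P : List (RStep V)} (hP : IsResDeriv F P) (hne : P ≠ [])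
    (hlast : P.getLast?.map RStep.clause = some ∅) :
    HasLevelRefutation F (derivHeight P) (3 * P.length) := by
  obtain ⟨y⟩ := ‹Nonempty V›
  have h0 : 0 < P.length := List.length_pos_iff.2 hne
  let src (i u : ℕ) : ℕ := if AvailableAt P i u then u else 0
  have hsrc (i u : ℕ) : AvailableAt P i (src i u) := by
    by_cases h : AvailableAt P i u
    · simpa only [src, if_pos h] using h
    · simpa only [src, if_neg h] using (hP.availableAt_zero_zero hne).mono (Nat.zero_le i)
  let Cl (i j : ℕ) : Clause V :=
    padClause y (clauseAt P (src (i - 1) ((j - 1) / 3))) ((j - 1) % 3)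
  have hCl {i u : ℕ} (r : ℕ) (hr : r < 3) (hu : AvailableAt P (i - 1) u) :
      Cl i (3 * u + r + 1) = padClause y (clauseAt P u) r := by
    have h₁ : (3 * u + r + 1 - 1) / 3 = u := by omega
    have h₂ : (3 * u + r + 1 - 1) % 3 = r := by omega
    simp only [Cl, h₁, h₂, src, if_pos hu]
  have hmem {i u : ℕ} (r : ℕ) (hr : r < 3) (hu : AvailableAt P i u) :
      3 * u + r + 1 ∈ Finset.Icc 1 (3 * P.length) := by
    have := hu.lt_length
    rw [Finset.mem_Icc]
    omega
  refine ⟨Cl, ?_, ?_, ?_⟩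
  · intro j _
    obtain ⟨C, hC⟩ := hsrc 0 ((j - 1) / 3)
    obtain ⟨C₀, hC₀, hsub⟩ := hP.subset_clauseAt hC
    exact ⟨C₀, hC₀, hsub.trans (subset_padClause _ _ _)⟩
  · intro i hi j _
    obtain ⟨i, rfl⟩ : ∃ k, i = k + 2 := ⟨i - 2, by have := Finset.mem_Icc.1 hi; omega⟩
    have hsub : clauseAt P (src (i + 1) ((j - 1) / 3)) ⊆ Cl (i + 2) j := subset_padClause _ _ _
    rcases hsrc (i + 1) ((j - 1) / 3) with hu | ⟨C, v, w, x, hC, hv, hw⟩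
    · refine ⟨_, hmem 0 (by omega) hu, _, hmem 1 (by omega) hu, y, ?_⟩
      rw [hCl (i := i + 2 - 1) 0 (by omega) hu, hCl (i := i + 2 - 1) 1 (by omega) hu]
      refine ⟨Finset.mem_insert_self _ _, Finset.mem_insert_self _ _, Finset.Subset.trans ?_ hsub⟩
      exact Finset.union_subset (Finset.erase_insert_subset _ _) (Finset.erase_insert_subset _ _)
    · refine ⟨_, hmem 2 (by omega) hv, _, hmem 2 (by omega) hw, x, ?_⟩
      rw [hCl (i := i + 2 - 1) 2 (by omega) hv, hCl (i := i + 2 - 1) 2 (by omega) hw]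
      obtain ⟨h₁, h₂, h₃⟩ := hP.resolvent_subset_clauseAt hC
      exact ⟨h₁, h₂, h₃.trans hsub⟩
  · have hend : 3 * P.length = 3 * (P.length - 1) + 2 + 1 := by omega
    rw [hend, hCl 2 (by omega) (hP.availableAt_height (by omega))]
    rw [List.getLast?_eq_getElem?] at hlast
    simp [padClause, clauseAt, hlast]

/-- If an `(n-1)`-CNF `F` in `n` variables has a resolution refutation of
height `h` and length `s`, then `F` has a resolution refutation of `h` levels of `3s`
clauses. -/
theorem height_to_levels (n h s : ℕ) (F : Cnf ℕ)
    (hF : ∀ C ∈ F, C.card ≤ n - 1 ∧ ∀ l ∈ C, l.var ∈ Finset.Icc 1 n)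
    (P : List (RStep ℕ))
    (hderiv : IsResDeriv (↑F : Set (Clause ℕ)) P)
    (hne : P ≠ [])
    (hlast : P.getLast?.map RStep.clause = some (∅ : Clause ℕ))
    (hheight : derivHeight P = h) (hlen : P.length = s) :
    HasLevelRefutation (↑F : Set (Clause ℕ)) h (3 * s) := by
  subst hheight hlen
  exact hderiv.hasLevelRefutation hne hlast
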